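/- Pushouts preserve trivial cofibrations of *-categories: in the category StarCat of small *-categories and *-functors, consider a pushout square with morphisms i : A ⟶ B, f : A ⟶ C, g : B ⟶ D and j : C ⟶ D satisfying i ≫ g = f ≫ j. If i is injective on objects and a unitary equivalence, then j is injective on objects and a unitary equivalence. -/

import Mathlib

open CategoryTheory

universe v u

/-- A `*`-category: a category with an involution fixing objects. -/
class StarCategoryStruct (C : Type u) [Category.{v} C] : Type (max u v) where
  star : ∀ {X Y : C}, (X ⟶ Y) → (Y ⟶ X)
  star_star : ∀ {X Y : C} (f : X ⟶ Y), star (star f) = f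
  star_id : ∀ X : C, star (𝟙 X) = 𝟙 X
  star_comp : ∀ {X Y Z : C} (f : X ⟶ Y) (g : Y ⟶ Z), star (f ≫ g) = star g ≫ star f

/-- A morphism is unitary if its star is a two-sided inverse. -/
def IsUnitary {C : Type*} [Category C] [StarCategoryStruct C] {X Y : C} (u : X ⟶ Y) : Prop :=
  u ≫ StarCategoryStruct.star u = 𝟙 X ∧ StarCategoryStruct.star u ≫ u = 𝟙 Y

/-- A functor between `*`-categories is a `*`-functor if it preserves the involution. -/
def IsStarFunctor {C D : Type*} [Category C] [Category D]
    [StarCategoryStruct C] [StarCategoryStruct D] (F : C ⥤ D) : Prop :=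
  ∀ {X Y : C} (f : X ⟶ Y),
    F.map (StarCategoryStruct.star f) = StarCategoryStruct.star (F.map f)

/-- A `*`-functor is a unitary equivalence if it admits a `*`-functor inverse up to unitary
natural isomorphisms. -/
def IsUnitaryEquivalence {C D : Type*} [Category C] [Category D]
    [StarCategoryStruct C] [StarCategoryStruct D] (F : C ⥤ D) : Prop :=
  ∃ G : D ⥤ C, IsStarFunctor G ∧
    ∃ (η : F ⋙ G ≅ 𝟭 C) (ε : G ⋙ F ≅ 𝟭 D),
      (∀ X : C, IsUnitary (η.hom.app X)) ∧ (∀ Y : D, IsUnitary (ε.hom.app Y))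

/-- A `*`-functor is good (a unitary isofibration) if unitary morphisms out of an image object
lift along it. -/
def IsGood {C D : Type*} [Category C] [Category D]
    [StarCategoryStruct C] [StarCategoryStruct D] (F : C ⥤ D) : Prop :=
  ∀ (c : C) (d : D) (u : F.obj c ⟶ d), IsUnitary u →
    ∃ (c' : C) (h : F.obj c' = d) (v : c ⟶ c'),
      IsUnitary v ∧ F.map v ≫ eqToHom h = u
/-- A bundled small `*`-category. -/
structure StarCat : Type (u + 1) where
  carrier : Type u
  [cat : SmallCategory carrier]
  [str : StarCategoryStruct carrier]

attribute [instance] StarCat.cat StarCat.str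

instance : CoeSort StarCat.{u} (Type u) :=
  ⟨StarCat.carrier⟩

theorem isStarFunctor_id {C : Type*} [Category C] [StarCategoryStruct C] :
    IsStarFunctor (𝟭 C) := fun _ => rfl

theorem IsStarFunctor.comp {C D E : Type*} [Category C] [Category D] [Category E]
    [StarCategoryStruct C] [StarCategoryStruct D] [StarCategoryStruct E]
    {F : C ⥤ D} {G : D ⥤ E} (hF : IsStarFunctor F) (hG : IsStarFunctor G) :
    IsStarFunctor (F ⋙ G) := by
  intro X Y f
  show G.map (F.map _) = _
  rw [hF f, hG]
  rfl

/-- The category of small `*`-categories and `*`-functors. -/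
instance : Category StarCat.{u} where
  Hom A B := { F : A.carrier ⥤ B.carrier // IsStarFunctor F }
  id A := ⟨𝟭 A.carrier, isStarFunctor_id⟩
  comp F G := ⟨F.1 ⋙ G.1, IsStarFunctor.comp F.2 G.2⟩
  id_comp F := Subtype.ext (Functor.id_comp F.1)
  comp_id F := Subtype.ext (Functor.comp_id F.1)
  assoc F G H := Subtype.ext (Functor.assoc F.1 G.1 H.1)

open StarCategoryStruct

section

variable {C : Type*} [Category C] [StarCategoryStruct C]

theorem isUnitary_id (X : C) : IsUnitary (𝟙 X) := by
  simp [IsUnitary, star_id]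

theorem isUnitary_eqToHom {X Y : C} (h : X = Y) : IsUnitary (eqToHom h) := by
  subst h
  exact isUnitary_id X

theorem IsUnitary.comp {X Y Z : C} {p : X ⟶ Y} {q : Y ⟶ Z} (hp : IsUnitary p)
    (hq : IsUnitary q) : IsUnitary (p ≫ q) := by
  constructor
  · rw [star_comp, Category.assoc, reassoc_of% hq.1, hp.1]
  · rw [star_comp, Category.assoc, reassoc_of% hp.2, hq.2]

theorem IsUnitary.map {D : Type*} [Category D] [StarCategoryStruct D] {F : C ⥤ D}
    (hF : IsStarFunctor F) {X Y : C} {p : X ⟶ Y} (hp : IsUnitary p) : IsUnitary (F.map p) := by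
  constructor
  · rw [← hF, ← F.map_comp, hp.1, F.map_id]
  · rw [← hF, ← F.map_comp, hp.2, F.map_id]

theorem IsUnitaryEquivalence.isEquivalence {D : Type*} [Category D] [StarCategoryStruct D]
    {F : C ⥤ D} (hF : IsUnitaryEquivalence F) : F.IsEquivalence := by
  obtain ⟨G, -, η, ε, -, -⟩ := hF
  exact (CategoryTheory.Equivalence.mk F G η.symm ε).isEquivalence_functor

end

/-- The unitary morphisms of a `*`-category, the objects of its path `*`-category. -/
structure UnitaryArrow (C : Type u) [Category.{v} C] [StarCategoryStruct C] :
    Type (max u v) where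
  src : C
  tgt : C
  hom : src ⟶ tgt
  isUnitary : IsUnitary hom

namespace UnitaryArrow

variable {C : Type u} [Category.{v} C] [StarCategoryStruct C]

/-- A morphism of unitary arrows is determined by its component on sources; the component on
targets is obtained by conjugation. -/
@[ext]
structure Hom (X Y : UnitaryArrow C) where
  src : X.src ⟶ Y.src

@[simps]
instance : Category (UnitaryArrow C) where
  Hom := Hom
  id X := ⟨𝟙 X.src⟩
  comp p q := ⟨p.src ≫ q.src⟩

@[ext]
theorem hom_ext {X Y : UnitaryArrow C} {p q : X ⟶ Y} (h : p.src = q.src) : p = q :=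
  Hom.ext h

instance : StarCategoryStruct (UnitaryArrow C) where
  star p := ⟨star p.src⟩
  star_star p := hom_ext (StarCategoryStruct.star_star p.src)
  star_id X := hom_ext (star_id X.src)
  star_comp p q := hom_ext (star_comp p.src q.src)

variable (C) in
/-- The source projection of the path `*`-category. -/
@[simps]
def srcFunctor : UnitaryArrow C ⥤ C where
  obj := src
  map p := p.src

variable (C) in
/-- The target projection of the path `*`-category. -/
@[simps]
def tgtFunctor : UnitaryArrow C ⥤ C where
  obj := tgt
  map {X Y} p := star X.hom ≫ p.src ≫ Y.hom
  map_id X := by simpa using X.isUnitary.2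
  map_comp {X Y Z} p q := by
    have := Y.isUnitary.1
    simp [reassoc_of% this]

theorem isStarFunctor_srcFunctor : IsStarFunctor (srcFunctor C) := fun _ => rfl

theorem isStarFunctor_tgtFunctor : IsStarFunctor (tgtFunctor C) := by
  intro X Y p
  have h : star Y.hom ≫ star p.src ≫ X.hom = star (star X.hom ≫ p.src ≫ Y.hom) := by
    simp only [star_comp, StarCategoryStruct.star_star, Category.assoc]
  exact h

instance : (srcFunctor C).Faithful where
  map_injective h := hom_ext h

theorem ext_of_eqToHom {X Y : UnitaryArrow C} (hs : X.src = Y.src) (ht : X.tgt = Y.tgt)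
    (hX : ∃ h : X.src = X.tgt, X.hom = eqToHom h)
    (hY : ∃ h : Y.src = Y.tgt, Y.hom = eqToHom h) : X = Y := by
  obtain ⟨s, t, p, hp⟩ := X
  obtain ⟨s', t', p', hp'⟩ := Y
  obtain rfl : s = s' := hs
  obtain rfl : t = t' := ht
  obtain ⟨_, hX⟩ := hX
  obtain ⟨_, hY⟩ := hY
  obtain rfl : p = p' := hX.trans hY.symm
  rfl

/-- The tautological natural isomorphism between the projections. -/
def projectionIso : srcFunctor C ≅ tgtFunctor C :=
  NatIso.ofComponents
    (fun X => ⟨X.hom, star X.hom, X.isUnitary.1, X.isUnitary.2⟩)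
    (fun {X Y} p => by
      have h : p.src ≫ Y.hom = X.hom ≫ star X.hom ≫ p.src ≫ Y.hom := by
        rw [reassoc_of% X.isUnitary.1]
      exact h)

theorem isUnitary_projectionIso (X : UnitaryArrow C) :
    IsUnitary (projectionIso.hom.app X) :=
  X.isUnitary

/-- The functor into the path `*`-category given by a functor and a family of unitary
morphisms out of its values. -/
def lift {B : Type*} [Category B] (F : B ⥤ C) (T : B → C) (φ : ∀ b, F.obj b ⟶ T b)
    (hφ : ∀ b, IsUnitary (φ b)) : B ⥤ UnitaryArrow C where
  obj b := ⟨F.obj b, T b, φ b, hφ b⟩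
  map p := ⟨F.map p⟩

theorem isStarFunctor_lift {B : Type*} [Category B] [StarCategoryStruct B] {F : B ⥤ C}
    (hF : IsStarFunctor F) (T : B → C) (φ : ∀ b, F.obj b ⟶ T b)
    (hφ : ∀ b, IsUnitary (φ b)) : IsStarFunctor (lift F T φ hφ) :=
  fun p => UnitaryArrow.hom_ext (hF p)

theorem lift_comp_tgtFunctor {B : Type*} [Category B] (F G : B ⥤ C) (φ : F ⟶ G)
    (hφ : ∀ b, IsUnitary (φ.app b)) : lift F G.obj φ.app hφ ⋙ tgtFunctor C = G := by
  refine CategoryTheory.Functor.ext (fun _ => rfl) fun X Y p => ?_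
  have h : star (φ.app X) ≫ F.map p ≫ φ.app Y = G.map p := by
    rw [φ.naturality, reassoc_of% (hφ X).2]
  exact h.trans ((Category.id_comp _).trans (Category.comp_id _)).symm

theorem functor_ext {B : Type*} [Category B] {F G : B ⥤ UnitaryArrow C}
    (hs : F ⋙ srcFunctor C = G ⋙ srcFunctor C) (ho : ∀ b, F.obj b = G.obj b) : F = G := by
  refine CategoryTheory.Functor.ext ho fun X Y p => (srcFunctor C).map_injective ?_
  rw [Functor.map_comp, Functor.map_comp, eqToHom_map, eqToHom_map]
  exact Functor.congr_hom hs p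

end UnitaryArrow

/-- A unitary equivalence which is injective on objects is the inclusion of a strong unitary
deformation retract. -/
theorem IsUnitaryEquivalence.exists_deformationRetraction {A B : Type*} [Category A] [Category B]
    [StarCategoryStruct A] [StarCategoryStruct B] {i : A ⥤ B} (hi : IsStarFunctor i)
    (hinj : Function.Injective i.obj) (he : IsUnitaryEquivalence i) :
    ∃ r : B ⥤ A, IsStarFunctor r ∧ i ⋙ r = 𝟭 A ∧
      ∃ φ : r ⋙ i ⟶ 𝟭 B, (∀ b, IsUnitary (φ.app b)) ∧
        ∀ a, ∃ h : i.obj (r.obj (i.obj a)) = i.obj a, φ.app (i.obj a) = eqToHom h := by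
  have := he.isEquivalence
  obtain ⟨G, -, -, ε, -, hε⟩ := he
  have key : ∀ b : B, ∃ (a : A) (p : i.obj a ⟶ b), IsUnitary p ∧
      ∀ a', i.obj a' = b → ∃ h : i.obj a = b, p = eqToHom h := by
    intro b
    by_cases hb : ∃ a, i.obj a = b
    · obtain ⟨a, h⟩ := hb
      exact ⟨a, eqToHom h, isUnitary_eqToHom h, fun _ _ => ⟨h, rfl⟩⟩
    · exact ⟨G.obj b, ε.hom.app b, hε b, fun a' h => (hb ⟨a', h⟩).elim⟩
  choose R φ hφ hR using key
  let r : B ⥤ A :=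
    { obj := R
      map := fun {X Y} p => i.preimage (φ X ≫ p ≫ star (φ Y))
      map_id := fun X => i.map_injective (by simp [(hφ X).1])
      map_comp := fun {X Y Z} p q => i.map_injective (by
        have := (hφ Y).2
        simp [reassoc_of% this]) }
  have hr : ∀ {X Y : B} (p : X ⟶ Y), i.map (r.map p) = φ X ≫ p ≫ star (φ Y) :=
    fun p => i.map_preimage _
  refine ⟨r, ?_, ?_, ⟨φ, ?_⟩, hφ, fun a => hR _ a rfl⟩
  · intro X Y p
    apply i.map_injective
    rw [hi, hr, hr]
    simp [star_comp, StarCategoryStruct.star_star]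
  · refine CategoryTheory.Functor.ext (fun a => hinj (hR _ a rfl).1) fun X Y p =>
      i.map_injective ?_
    obtain ⟨hX, eX⟩ := hR _ X rfl
    obtain ⟨hY, eY⟩ := hR _ Y rfl
    have hs : star (φ (i.obj Y)) = eqToHom hY.symm := by
      have := (hφ (i.obj Y)).1
      rw [eY] at this ⊢
      rw [← cancel_epi (eqToHom hY), this]
      simp
    simp only [Functor.comp_map, hr, Functor.map_comp, eqToHom_map, hs, eX, Functor.id_map]
  · intro X Y p
    simp only [Functor.comp_map, hr, Category.assoc, (hφ Y).2, Functor.id_map]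
    exact congrArg _ (Category.comp_id p)

/-- Pushouts in the category of small `*`-categories preserve trivial cofibrations. -/
theorem isPushout_trivialCofibration
    {A B C D : StarCat.{u}} (i : A ⟶ B) (f : A ⟶ C) (g : B ⟶ D) (j : C ⟶ D)
    (sq : IsPushout i f g j)
    (hiinj : Function.Injective i.1.obj) (hiequiv : IsUnitaryEquivalence i.1) :
    Function.Injective j.1.obj ∧ IsUnitaryEquivalence j.1 := by
  obtain ⟨r₀, hr₀, hir, φ, hφ, hφi⟩ := hiequiv.exists_deformationRetraction i.2 hiinj
  let r : B ⟶ A := ⟨r₀, hr₀⟩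
  have hir : i ≫ r = 𝟙 A := Subtype.ext hir
  let s : D ⟶ C := sq.desc (r ≫ f) (𝟙 C) (by rw [reassoc_of% hir, Category.comp_id])
  have hgs : g ≫ s = r ≫ f := sq.inl_desc _ _ _
  have hjs : j ≫ s = 𝟙 C := sq.inr_desc _ _ _
  have hjs' : j.1 ⋙ s.1 = 𝟭 C := congrArg Subtype.val hjs
  let P : StarCat.{u} := ⟨UnitaryArrow D⟩
  let p₀ : P ⟶ D := ⟨UnitaryArrow.srcFunctor D, UnitaryArrow.isStarFunctor_srcFunctor⟩
  let p₁ : P ⟶ D := ⟨UnitaryArrow.tgtFunctor D, UnitaryArrow.isStarFunctor_tgtFunctor⟩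
  let ψ : (r ≫ i ≫ g).1 ⟶ g.1 := Functor.whiskerRight φ g.1
  have hψ : ∀ b, IsUnitary (ψ.app b) := fun b => (hφ b).map g.2
  let hB : B ⟶ P := ⟨UnitaryArrow.lift _ g.1.obj ψ.app hψ,
    UnitaryArrow.isStarFunctor_lift (r ≫ i ≫ g).2 _ _ _⟩
  let hC : C ⟶ P := ⟨UnitaryArrow.lift j.1 j.1.obj (𝟙 j.1 :).app (fun _ => isUnitary_id _),
    UnitaryArrow.isStarFunctor_lift j.2 _ _ _⟩
  have hB₀ : hB ≫ p₀ = r ≫ i ≫ g := rfl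
  have hC₀ : hC ≫ p₀ = j := rfl
  have hB₁ : hB ≫ p₁ = g := Subtype.ext (UnitaryArrow.lift_comp_tgtFunctor _ _ ψ hψ)
  have hC₁ : hC ≫ p₁ = j :=
    Subtype.ext (UnitaryArrow.lift_comp_tgtFunctor _ _ (𝟙 j.1) (fun _ => isUnitary_id _))
  have w₀ : (i ≫ hB) ≫ p₀ = (f ≫ hC) ≫ p₀ := by
    rw [Category.assoc, Category.assoc, hB₀, hC₀, reassoc_of% hir, sq.w]
  have w₁ : (i ≫ hB) ≫ p₁ = (f ≫ hC) ≫ p₁ := by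
    rw [Category.assoc, Category.assoc, hB₁, hC₁, sq.w]
  have w : i ≫ hB = f ≫ hC := by
    refine Subtype.ext (UnitaryArrow.functor_ext (congrArg Subtype.val w₀) fun a => ?_)
    refine UnitaryArrow.ext_of_eqToHom
      (Functor.congr_obj (congrArg Subtype.val w₀) a)
      (Functor.congr_obj (congrArg Subtype.val w₁) a) ?_ ⟨rfl, rfl⟩
    obtain ⟨h, e⟩ := hφi a
    exact ⟨congrArg g.1.obj h, (congrArg g.1.map e).trans (eqToHom_map _ _)⟩
  let H : D ⟶ P := sq.desc hB hC w
  have hgH : g ≫ H = hB := sq.inl_desc _ _ _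
  have hjH : j ≫ H = hC := sq.inr_desc _ _ _
  have H₀ : H ≫ p₀ = s ≫ j := by
    apply sq.hom_ext
    · rw [reassoc_of% hgH, hB₀, reassoc_of% hgs, sq.w]
    · rw [reassoc_of% hjH, hC₀, reassoc_of% hjs]
  have H₁ : H ≫ p₁ = 𝟙 D := by
    apply sq.hom_ext
    · rw [reassoc_of% hgH, hB₁, Category.comp_id]
    · rw [reassoc_of% hjH, hC₁, Category.comp_id]
  have H₀' : s.1 ⋙ j.1 = H.1 ⋙ UnitaryArrow.srcFunctor D := (congrArg Subtype.val H₀).symm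
  have H₁' : H.1 ⋙ UnitaryArrow.tgtFunctor D = 𝟭 D := congrArg Subtype.val H₁
  refine ⟨Function.LeftInverse.injective (g := s.1.obj) fun c => Functor.congr_obj hjs' c,
    s.1, s.2, eqToIso hjs',
    eqToIso H₀' ≪≫ Functor.isoWhiskerLeft H.1 UnitaryArrow.projectionIso ≪≫ eqToIso H₁',
    fun c => ?_, fun d => ?_⟩
  · rw [eqToIso.hom, eqToHom_app]
    exact isUnitary_eqToHom _
  · simp only [Iso.trans_hom, eqToIso.hom, NatTrans.comp_app, eqToHom_app]
    exact (isUnitary_eqToHom _).comp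
      ((UnitaryArrow.isUnitary_projectionIso _).comp (isUnitary_eqToHom _))
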